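/- For every r ≥ 1, the number of vertices of the convex hull of the set of integer points in the closed disk of radius r centered at the origin in ℝ² is Θ(r^{2/3}); in particular, it is at least c·r^{2/3} and at most C·r^{2/3} for absolute constants c, C > 0 (for r sufficiently large). -/

import Mathlib

/-- The set of integer points in the closed disk of radius `r` around the origin in `ℝ²`. -/
def latticeDisk (r : ℝ) : Set (ℝ × ℝ) :=
  {p | (∃ a b : ℤ, p = ((a : ℝ), (b : ℝ))) ∧ p.1 ^ 2 + p.2 ^ 2 ≤ r ^ 2}

open Finset in
theorem sum_one_div_sq_le {n : ℕ} (hn : 2 ≤ n) :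
    ∑ d ∈ Icc 2 n, (1 : ℝ) / (d : ℝ) ^ 2 ≤ 3 / 4 - 1 / n := by
  induction n, hn using Nat.le_induction with
  | base => norm_num
  | succ m hm ih =>
    rw [sum_Icc_succ_top (by omega)]
    have hm' : (0 : ℝ) < m := by exact_mod_cast (by omega : 0 < m)
    have key : (1 : ℝ) / ((m + 1 : ℕ) : ℝ) ^ 2 ≤ 1 / m - 1 / ((m + 1 : ℕ) : ℝ) := by
      push_cast
      rw [div_sub_div _ _ (by positivity) (by positivity),
        div_le_div_iff₀ (by positivity) (by positivity)]
      nlinarith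
    linarith

open Finset in
/-- At least a quarter of the pairs in `{1, …, n}²` are coprime. -/
theorem sq_le_four_mul_card_coprime (n : ℕ) :
    (n : ℝ) ^ 2 ≤
      4 * (#{p ∈ Icc 1 n ×ˢ Icc 1 n | p.1.Coprime p.2} : ℝ) := by
  rcases Nat.lt_or_ge n 2 with hn | hn
  · interval_cases n
    · simp
    · have : {p ∈ Icc 1 1 ×ˢ Icc 1 1 | p.1.Coprime p.2} = {((1 : ℕ), (1 : ℕ))} := by decide
      rw [this]; norm_num
  have hsub : {p ∈ Icc 1 n ×ˢ Icc 1 n | ¬ p.1.Coprime p.2} ⊆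
      (Icc 2 n).biUnion fun d => {a ∈ Ioc 0 n | d ∣ a} ×ˢ {a ∈ Ioc 0 n | d ∣ a} := by
    rintro ⟨a, b⟩ hp
    simp only [mem_filter, mem_product, mem_Icc, Nat.Coprime] at hp
    obtain ⟨⟨⟨ha, ha'⟩, hb, hb'⟩, hab⟩ := hp
    have h1 : Nat.gcd a b ≤ a := Nat.gcd_le_left _ ha
    have h0 : 0 < Nat.gcd a b := Nat.gcd_pos_of_pos_left _ ha
    simp only [mem_biUnion, mem_product, mem_filter, mem_Icc, mem_Ioc]
    exact ⟨Nat.gcd a b, by omega, ⟨by omega, Nat.gcd_dvd_left _ _⟩,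
      ⟨by omega, Nat.gcd_dvd_right _ _⟩⟩
  have hcard : #{p ∈ Icc 1 n ×ˢ Icc 1 n | ¬ p.1.Coprime p.2} ≤ ∑ d ∈ Icc 2 n, (n / d) ^ 2 := by
    refine (card_le_card hsub).trans (card_biUnion_le.trans (le_of_eq ?_))
    refine sum_congr rfl fun d _ => ?_
    rw [card_product, Nat.Ioc_filter_dvd_card_eq_div, sq]
  have hreal : (#{p ∈ Icc 1 n ×ˢ Icc 1 n | ¬ p.1.Coprime p.2} : ℝ) ≤ n ^ 2 * (3 / 4) := by
    calc (#{p ∈ Icc 1 n ×ˢ Icc 1 n | ¬ p.1.Coprime p.2} : ℝ)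
        ≤ ((∑ d ∈ Icc 2 n, (n / d) ^ 2 : ℕ) : ℝ) := by exact_mod_cast hcard
      _ = ∑ d ∈ Icc 2 n, ((n / d : ℕ) : ℝ) ^ 2 := by push_cast; rfl
      _ ≤ ∑ d ∈ Icc 2 n, (n : ℝ) ^ 2 * (1 / (d : ℝ) ^ 2) := by
          refine sum_le_sum fun d _ => ?_
          rw [mul_one_div, ← div_pow]
          gcongr
          exact Nat.cast_div_le
      _ ≤ n ^ 2 * (3 / 4) := by
          rw [← mul_sum]
          gcongr
          exact (sum_one_div_sq_le hn).trans (by simp)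
  have htot := card_filter_add_card_filter_not (s := Icc 1 n ×ˢ Icc 1 n)
    (fun p : ℕ × ℕ => p.1.Coprime p.2)
  rw [card_product, Nat.card_Icc, Nat.add_sub_cancel] at htot
  have htot' : (#{p ∈ Icc 1 n ×ˢ Icc 1 n | p.1.Coprime p.2} : ℝ) +
      #{p ∈ Icc 1 n ×ˢ Icc 1 n | ¬ p.1.Coprime p.2} = n * n := by exact_mod_cast htot
  nlinarith

open Finset in
/-- A finite set of integer points, each of which is the strict maximizer over the set of a
functional `(x, y) ↦ s x + y` with `|s| ≤ 1`, has few elements: consecutive points differ by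
pairwise distinct vectors of slope at most one, and only few of these vectors are long. -/
theorem card_le_of_forall_strict_support {α : Type*} (U : Finset α) (x y : α → ℤ) {R K : ℤ}
    (hR : 0 ≤ R) (hK : 0 < K) (hx : ∀ p ∈ U, |x p| ≤ R)
    (h : ∀ p ∈ U, ∃ s : ℝ, |s| ≤ 1 ∧ ∀ q ∈ U, q ≠ p → s * x q + y q < s * x p + y p) :
    (#U : ℝ) ≤ 3 + 2 * R / K + K * (2 * K + 1) := by
  classical
  choose! s hs1 hs using h
  have hlip : ∀ p ∈ U, ∀ q ∈ U, (y q : ℝ) - y p ≤ |(x q : ℝ) - x p| := by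
    intro p hp q hq
    rcases eq_or_ne q p with rfl | hne
    · simp
    · have h1 := hs p hp q hq hne
      have h2 : -(s p * ((x q : ℝ) - x p)) ≤ |s p * ((x q : ℝ) - x p)| := neg_le_abs _
      have h3 : |s p * ((x q : ℝ) - x p)| ≤ 1 * |(x q : ℝ) - x p| := by
        rw [abs_mul]; gcongr; exact hs1 p hp
      linarith
  have hinj : ∀ p ∈ U, ∀ q ∈ U, x p = x q → p = q := by
    intro p hp q hq hpq
    by_contra hne
    have h1 := hs p hp q hq (Ne.symm hne)
    have h2 := hs q hq p hp hne
    rw [hpq] at h1 h2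
    linarith
  set S := {p ∈ U | ∃ q ∈ U, x p < x q} with hS
  have hnext : ∀ p ∈ S, ∃ q ∈ U, x p < x q ∧ ∀ q' ∈ U, x p < x q' → x q ≤ x q' := by
    intro p hp
    obtain ⟨hpU, q₀, hq₀, hlt⟩ := mem_filter.1 hp
    obtain ⟨q, hq, hmin⟩ := exists_min_image {q ∈ U | x p < x q} x
      ⟨q₀, mem_filter.2 ⟨hq₀, hlt⟩⟩
    exact ⟨q, (mem_filter.1 hq).1, (mem_filter.1 hq).2,
      fun q' h1 h2 => hmin q' (mem_filter.2 ⟨h1, h2⟩)⟩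
  choose! nx hnxU hnxlt hnxmin using hnext
  have hSU : ∀ p ∈ S, p ∈ U := fun p hp => (mem_filter.1 hp).1
  have hlast : #{p ∈ U | ¬ ∃ q ∈ U, x p < x q} ≤ 1 := by
    refine card_le_one.2 fun p hp q hq => ?_
    obtain ⟨hpU, hp⟩ := mem_filter.1 hp
    obtain ⟨hqU, hq⟩ := mem_filter.1 hq
    push Not at hp hq
    exact hinj p hpU q hqU (le_antisymm (hq p hpU) (hp q hqU))
  have hbig : #{p ∈ S | K < x (nx p) - x p} ≤ #(Icc (-R / K) (R / K)) := by
    refine card_le_card_of_injOn (fun p => x p / K) ?_ ?_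
    · intro p hp
      have := abs_le.1 (hx p (hSU p (mem_filter.1 hp).1))
      exact mem_coe.2 (mem_Icc.2
        ⟨Int.ediv_le_ediv hK this.1, Int.ediv_le_ediv hK this.2⟩)
    · have key : ∀ p ∈ S, K < x (nx p) - x p → ∀ q ∈ S, x p < x q → x p / K ≠ x q / K := by
        intro p hp hgap q hq hlt heq
        have h1 := hnxmin p hp q (hSU q hq) hlt
        have h2 : x p / K + 1 ≤ x q / K := by
          have h3 := Int.ediv_le_ediv hK (by omega : x p + 1 * K ≤ x q)
          rwa [Int.add_mul_ediv_right _ _ hK.ne'] at h3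
        omega
      intro p hp q hq heq
      have hp := mem_filter.1 hp
      have hq := mem_filter.1 hq
      rcases lt_trichotomy (x p) (x q) with hlt | he | hgt
      · exact absurd heq (key p hp.1 hp.2 q hq.1 hlt)
      · exact hinj p (hSU p hp.1) q (hSU q hq.1) he
      · exact absurd heq.symm (key q hq.1 hq.2 p hp.1 hgt)
  have hsmall : #{p ∈ S | ¬ K < x (nx p) - x p} ≤ #(Icc 1 K ×ˢ Icc (-K) K) := by
    refine card_le_card_of_injOn (fun p => (x (nx p) - x p, y (nx p) - y p)) ?_ ?_
    · intro p hp
      obtain ⟨hpS, hgap⟩ := mem_filter.1 hp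
      have hlt := hnxlt p hpS
      have h1 := hlip p (hSU p hpS) (nx p) (hnxU p hpS)
      have h2 := hlip (nx p) (hnxU p hpS) p (hSU p hpS)
      have hpos : (0 : ℝ) ≤ (x (nx p) : ℝ) - x p := by
        rw [sub_nonneg]; exact_mod_cast hlt.le
      rw [abs_of_nonneg hpos] at h1
      rw [abs_sub_comm, abs_of_nonneg hpos] at h2
      have h1' : y (nx p) - y p ≤ x (nx p) - x p := by exact_mod_cast h1
      have h2' : y p - y (nx p) ≤ x (nx p) - x p := by exact_mod_cast h2
      simp only [coe_product, coe_Icc, Set.mem_prod, Set.mem_Icc]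
      omega
    · have key : ∀ p ∈ S, ∀ q ∈ S, x p < x q → x (nx p) - x p = x (nx q) - x q →
          y (nx p) - y p ≠ y (nx q) - y q := by
        intro p hp q hq hlt hX hY
        have hle := hnxmin p hp q (hSU q hq) hlt
        have hp1 := hs (nx p) (hnxU p hp) p (hSU p hp) (by
          intro he; have := hnxlt p hp; rw [← he] at this; exact lt_irrefl _ this)
        have hq1 := hs q (hSU q hq) (nx q) (hnxU q hq) (by
          intro he; have := hnxlt q hq; rw [he] at this; exact lt_irrefl _ this)
        have hX' : (x (nx p) : ℝ) - x p = x (nx q) - x q := by exact_mod_cast hX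
        have hY' : (y (nx p) : ℝ) - y p = y (nx q) - y q := by exact_mod_cast hY
        have hd : (0 : ℝ) < (x (nx p) : ℝ) - x p := by
          rw [sub_pos]; exact_mod_cast hnxlt p hp
        have hslope : s q < s (nx p) := by
          have h1 : 0 < (s (nx p) - s q) * ((x (nx p) : ℝ) - x p) := by
            have : s q * ((x (nx p) : ℝ) - x p) = s q * ((x (nx q) : ℝ) - x q) := by rw [hX']
            linarith
          exact sub_pos.1 (pos_of_mul_pos_left h1 hd.le)
        rcases eq_or_ne (nx p) q with he | hne
        · rw [he] at hslope; exact lt_irrefl _ hslope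
        · have h1 := hs (nx p) (hnxU p hp) q (hSU q hq) hne.symm
          have h2 := hs q (hSU q hq) (nx p) (hnxU p hp) hne
          have h3 : (x (nx p) : ℝ) ≤ x q := by exact_mod_cast hle
          nlinarith
      intro p hp q hq heq
      have hp := (mem_filter.1 hp).1
      have hq := (mem_filter.1 hq).1
      obtain ⟨hX, hY⟩ := Prod.mk.inj heq
      rcases lt_trichotomy (x p) (x q) with hlt | he | hgt
      · exact absurd hY (key p hp q hq hlt hX)
      · exact hinj p (hSU p hp) q (hSU q hq) he
      · exact absurd hY.symm (key q hq p hp hgt hX.symm)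
  have hsplitU := card_filter_add_card_filter_not (s := U) (fun p => ∃ q ∈ U, x p < x q)
  rw [← hS] at hsplitU
  have hsplitS := card_filter_add_card_filter_not (s := S) (fun p => K < x (nx p) - x p)
  have hKr : (0 : ℝ) < K := by exact_mod_cast hK
  have hcells : (#(Icc (-R / K) (R / K)) : ℝ) ≤ 2 * R / K + 2 := by
    have hle : -R / K ≤ R / K + 1 := by
      have := Int.ediv_le_ediv hK (by omega : -R ≤ R)
      omega
    have h1 : ((#(Icc (-R / K) (R / K)) : ℤ) : ℝ) = ((R / K + 1 - (-R / K) : ℤ) : ℝ) := by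
      rw [Int.card_Icc_of_le _ _ hle]
    have h2 : ((R / K : ℤ) : ℝ) ≤ R / K := by
      rw [le_div_iff₀ hKr]
      exact_mod_cast Int.ediv_mul_le R hK.ne'
    have h3 : ((-R / K : ℤ) : ℝ) ≥ -R / K - 1 := by
      have : (-R : ℤ) ≤ (-R / K) * K + K := by
        have := Int.lt_ediv_add_one_mul_self (-R) hK
        linarith
      have h' : (-R : ℝ) ≤ ((-R / K : ℤ) : ℝ) * K + K := by exact_mod_cast this
      rw [ge_iff_le, sub_le_iff_le_add, div_le_iff₀ hKr]
      linarith
    push_cast at h1 h3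
    rw [h1]
    have h4 : (2 * R / K : ℝ) = R / K - -R / K := by ring
    linarith
  have hvec : (#(Icc 1 K ×ˢ Icc (-K) K) : ℝ) = K * (2 * K + 1) := by
    have h1 : ((#(Icc 1 K ×ˢ Icc (-K) K) : ℤ)) = K * (2 * K + 1) := by
      rw [card_product]
      push_cast
      rw [Int.card_Icc_of_le _ _ (by omega), Int.card_Icc_of_le _ _ (by omega)]
      ring
    exact_mod_cast h1
  have htotal : #U ≤ 1 + #(Icc (-R / K) (R / K)) + #(Icc 1 K ×ˢ Icc (-K) K) := by
    omega
  have htotal' : (#U : ℝ) ≤ 1 + #(Icc (-R / K) (R / K)) + #(Icc 1 K ×ˢ Icc (-K) K) := by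
    exact_mod_cast htotal
  linarith

theorem mk_intCast_mem_latticeDisk {r : ℝ} {a b : ℤ} :
    ((a : ℝ), (b : ℝ)) ∈ latticeDisk r ↔ (a : ℝ) ^ 2 + (b : ℝ) ^ 2 ≤ r ^ 2 :=
  ⟨fun h => h.2, fun h => ⟨⟨a, b, rfl⟩, h⟩⟩

theorem abs_le_of_mem_latticeDisk {r : ℝ} (hr : 0 ≤ r) {p : ℝ × ℝ} (hp : p ∈ latticeDisk r) :
    |p.1| ≤ r ∧ |p.2| ≤ r :=
  ⟨abs_le_of_sq_le_sq (by nlinarith [hp.2, sq_nonneg p.2]) hr,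
    abs_le_of_sq_le_sq (by nlinarith [hp.2, sq_nonneg p.1]) hr⟩

theorem finite_latticeDisk {r : ℝ} (hr : 0 ≤ r) : (latticeDisk r).Finite := by
  refine (((Set.finite_Icc (-⌊r⌋) ⌊r⌋).prod (Set.finite_Icc (-⌊r⌋) ⌊r⌋)).image
    fun p : ℤ × ℤ => ((p.1 : ℝ), (p.2 : ℝ))).subset ?_
  intro p hp
  obtain ⟨h1, h2⟩ := abs_le_of_mem_latticeDisk hr hp
  obtain ⟨⟨a, b, rfl⟩, -⟩ := hp
  have key : ∀ c : ℤ, |(c : ℝ)| ≤ r → c ∈ Set.Icc (-⌊r⌋) ⌊r⌋ := fun c hc =>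
    abs_le.1 (Int.le_floor.2 (by push_cast; exact hc))
  exact ⟨(a, b), ⟨key a h1, key b h2⟩, rfl⟩

theorem extremePoints_latticeDisk_subset (r : ℝ) :
    Set.extremePoints ℝ (convexHull ℝ (latticeDisk r)) ⊆ latticeDisk r :=
  extremePoints_convexHull_subset

/-- An extreme point of the convex hull of a finite planar set is the strict maximizer of a
linear functional on that set. -/
theorem exists_strict_support_of_mem_extremePoints {B : Set (ℝ × ℝ)} (hB : B.Finite)
    {v : ℝ × ℝ} (hv : v ∈ Set.extremePoints ℝ (convexHull ℝ B)) :
    ∃ α β : ℝ, ∀ w ∈ B, w ≠ v → α * w.1 + β * w.2 < α * v.1 + β * v.2 := by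
  have h1 := ((convex_convexHull ℝ B).mem_extremePoints_iff_mem_sdiff_convexHull_sdiff.1 hv).2
  have h2 : v ∉ convexHull ℝ (B \ {v}) := fun h =>
    h1 (convexHull_mono (Set.sdiff_subset_sdiff_left (subset_convexHull ℝ B)) h)
  obtain ⟨f, u, hfu, huv⟩ := geometric_hahn_banach_closed_point (convex_convexHull ℝ (B \ {v}))
    ((hB.subset Set.sdiff_subset).isClosed_convexHull ℝ) h2
  have hf : ∀ p : ℝ × ℝ, f p = f (1, 0) * p.1 + f (0, 1) * p.2 := by
    intro p
    have : p = p.1 • ((1 : ℝ), (0 : ℝ)) + p.2 • ((0 : ℝ), (1 : ℝ)) := by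
      ext <;> simp
    conv_lhs => rw [this, map_add, map_smul, map_smul]
    simp only [smul_eq_mul]
    ring
  refine ⟨f (1, 0), f (0, 1), fun w hw hne => ?_⟩
  rw [← hf, ← hf]
  exact (hfu w (subset_convexHull ℝ _ ⟨hw, hne⟩)).trans huv

/-- The functional of `exists_strict_support_of_mem_extremePoints`, normalized so that its
coefficient of largest absolute value is `1` or `-1`. -/
theorem exists_normalized_support {B : Set (ℝ × ℝ)} {v : ℝ × ℝ} {α β : ℝ}
    (h : ∀ w ∈ B, w ≠ v → α * w.1 + β * w.2 < α * v.1 + β * v.2) :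
    ∃ s : ℝ, |s| ≤ 1 ∧
      ((∀ w ∈ B, w ≠ v → s * w.1 + w.2 < s * v.1 + v.2) ∨
       (∀ w ∈ B, w ≠ v → s * w.1 + -w.2 < s * v.1 + -v.2) ∨
       (∀ w ∈ B, w ≠ v → s * w.2 + w.1 < s * v.2 + v.1) ∨
       (∀ w ∈ B, w ≠ v → s * w.2 + -w.1 < s * v.2 + -v.1)) := by
  have key : ∀ α β : ℝ, |α| ≤ |β| → ∀ X Y : ℝ × ℝ → ℝ,
      (∀ w ∈ B, w ≠ v → α * X w + β * Y w < α * X v + β * Y v) →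
      ∃ s : ℝ, |s| ≤ 1 ∧ ((∀ w ∈ B, w ≠ v → s * X w + Y w < s * X v + Y v) ∨
        (∀ w ∈ B, w ≠ v → s * X w + -Y w < s * X v + -Y v)) := by
    intro α β hab X Y hXY
    refine ⟨α / |β|, ?_, ?_⟩
    · rw [abs_div, abs_abs]
      exact div_le_one_of_le₀ hab (abs_nonneg _)
    rcases lt_trichotomy β 0 with hβ | rfl | hβ
    · right
      intro w hw hne
      have h1 := hXY w hw hne
      have h2 := div_lt_div_of_pos_right h1 (neg_pos.2 hβ)
      have e : ∀ p, α / -β * X p + -Y p = (α * X p + β * Y p) / -β := fun p => by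
        have := hβ.ne
        field_simp
        ring
      rwa [abs_of_neg hβ, e, e]
    · left
      have hα : α = 0 := by simpa using hab
      intro w hw hne
      have h1 := hXY w hw hne
      simp [hα] at h1
    · left
      intro w hw hne
      have h1 := hXY w hw hne
      have h2 := div_lt_div_of_pos_right h1 hβ
      have e : ∀ p, α / β * X p + Y p = (α * X p + β * Y p) / β := fun p => by
        field_simp
      rwa [abs_of_pos hβ, e, e]
  rcases le_total |α| |β| with hab | hab
  · obtain ⟨s, hs, h' | h'⟩ := key α β hab Prod.fst Prod.snd h
    · exact ⟨s, hs, Or.inl h'⟩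
    · exact ⟨s, hs, Or.inr (Or.inl h')⟩
  · obtain ⟨s, hs, h' | h'⟩ := key β α hab Prod.snd Prod.fst
      (fun w hw hne => by linarith [h w hw hne])
    · exact ⟨s, hs, Or.inr (Or.inr (Or.inl h'))⟩
    · exact ⟨s, hs, Or.inr (Or.inr (Or.inr h'))⟩

open Finset in
theorem ncard_extremePoints_latticeDisk_le {r : ℝ} (hr : 0 ≤ r) {K : ℤ} (hK : 0 < K) :
    ((Set.extremePoints ℝ (convexHull ℝ (latticeDisk r))).ncard : ℝ) ≤
      4 * (3 + 2 * r / K + K * (2 * K + 1)) := by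
  classical
  have hB := finite_latticeDisk hr
  have hE := hB.subset (extremePoints_latticeDisk_subset r)
  have hEB : ∀ p ∈ hE.toFinset, p ∈ latticeDisk r := fun p hp =>
    extremePoints_latticeDisk_subset r (hE.mem_toFinset.1 hp)
  have hfloor : ∀ p ∈ latticeDisk r, ((⌊p.1⌋ : ℝ) = p.1) ∧ ((⌊p.2⌋ : ℝ) = p.2) := by
    rintro p ⟨⟨a, b, rfl⟩, -⟩
    simp
  have hbound : ∀ z : ℝ, ((⌊z⌋ : ℤ) : ℝ) = z → |z| ≤ r → |⌊z⌋| ≤ ⌊r⌋ := by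
    intro z hz hzr
    rw [Int.le_floor]
    push_cast
    rwa [hz]
  have hKr : (0 : ℝ) < K := by exact_mod_cast hK
  have hclass : ∀ x y : ℝ × ℝ → ℤ, (∀ p ∈ latticeDisk r, |x p| ≤ ⌊r⌋) →
      (#{v ∈ hE.toFinset | ∃ s : ℝ, |s| ≤ 1 ∧
        ∀ w ∈ latticeDisk r, w ≠ v → s * x w + y w < s * x v + y v} : ℝ) ≤
        3 + 2 * r / K + K * (2 * K + 1) := by
    intro x y hx
    refine (card_le_of_forall_strict_support _ x y (Int.floor_nonneg.2 hr) hK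
      (fun p hp => hx p (hEB p (mem_filter.1 hp).1)) ?_).trans ?_
    · intro p hp
      obtain ⟨s, hs, h⟩ := (mem_filter.1 hp).2
      exact ⟨s, hs, fun q hq hne => h q (hEB q (mem_filter.1 hq).1) hne⟩
    · gcongr
      exact Int.floor_le r
  have hx1 : ∀ p ∈ latticeDisk r, |⌊p.1⌋| ≤ ⌊r⌋ := fun p hp =>
    hbound _ (hfloor p hp).1 (abs_le_of_mem_latticeDisk hr hp).1
  have hx2 : ∀ p ∈ latticeDisk r, |⌊p.2⌋| ≤ ⌊r⌋ := fun p hp =>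
    hbound _ (hfloor p hp).2 (abs_le_of_mem_latticeDisk hr hp).2
  have c1 := hclass (fun p => ⌊p.1⌋) (fun p => ⌊p.2⌋) hx1
  have c2 := hclass (fun p => ⌊p.1⌋) (fun p => -⌊p.2⌋) hx1
  have c3 := hclass (fun p => ⌊p.2⌋) (fun p => ⌊p.1⌋) hx2
  have c4 := hclass (fun p => ⌊p.2⌋) (fun p => -⌊p.1⌋) hx2
  set U1 := {v ∈ hE.toFinset | ∃ s : ℝ, |s| ≤ 1 ∧ ∀ w ∈ latticeDisk r, w ≠ v →
    s * ((⌊w.1⌋ : ℤ) : ℝ) + ((⌊w.2⌋ : ℤ) : ℝ) < s * ((⌊v.1⌋ : ℤ) : ℝ) + ((⌊v.2⌋ : ℤ) : ℝ)}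
  set U2 := {v ∈ hE.toFinset | ∃ s : ℝ, |s| ≤ 1 ∧ ∀ w ∈ latticeDisk r, w ≠ v →
    s * ((⌊w.1⌋ : ℤ) : ℝ) + ((-⌊w.2⌋ : ℤ) : ℝ) < s * ((⌊v.1⌋ : ℤ) : ℝ) + ((-⌊v.2⌋ : ℤ) : ℝ)}
  set U3 := {v ∈ hE.toFinset | ∃ s : ℝ, |s| ≤ 1 ∧ ∀ w ∈ latticeDisk r, w ≠ v →
    s * ((⌊w.2⌋ : ℤ) : ℝ) + ((⌊w.1⌋ : ℤ) : ℝ) < s * ((⌊v.2⌋ : ℤ) : ℝ) + ((⌊v.1⌋ : ℤ) : ℝ)}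
  set U4 := {v ∈ hE.toFinset | ∃ s : ℝ, |s| ≤ 1 ∧ ∀ w ∈ latticeDisk r, w ≠ v →
    s * ((⌊w.2⌋ : ℤ) : ℝ) + ((-⌊w.1⌋ : ℤ) : ℝ) < s * ((⌊v.2⌋ : ℤ) : ℝ) + ((-⌊v.1⌋ : ℤ) : ℝ)}
  have hcover : hE.toFinset ⊆ (U1 ∪ U2) ∪ (U3 ∪ U4) := by
    intro v hv
    have hvB := hEB v hv
    obtain ⟨α, β, hαβ⟩ := exists_strict_support_of_mem_extremePoints hB (hE.mem_toFinset.1 hv)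
    obtain ⟨s, hs, h⟩ := exists_normalized_support hαβ
    simp only [mem_union]
    rcases h with h | h | h | h
    · refine Or.inl (Or.inl (mem_filter.2 ⟨hv, s, hs, fun w hw hne => ?_⟩))
      rw [(hfloor w hw).1, (hfloor w hw).2, (hfloor v hvB).1, (hfloor v hvB).2]
      exact h w hw hne
    · refine Or.inl (Or.inr (mem_filter.2 ⟨hv, s, hs, fun w hw hne => ?_⟩))
      push_cast
      rw [(hfloor w hw).1, (hfloor w hw).2, (hfloor v hvB).1, (hfloor v hvB).2]
      exact h w hw hne
    · refine Or.inr (Or.inl (mem_filter.2 ⟨hv, s, hs, fun w hw hne => ?_⟩))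
      rw [(hfloor w hw).1, (hfloor w hw).2, (hfloor v hvB).1, (hfloor v hvB).2]
      exact h w hw hne
    · refine Or.inr (Or.inr (mem_filter.2 ⟨hv, s, hs, fun w hw hne => ?_⟩))
      push_cast
      rw [(hfloor w hw).1, (hfloor w hw).2, (hfloor v hvB).1, (hfloor v hvB).2]
      exact h w hw hne
  have hcard : #hE.toFinset ≤ #U1 + #U2 + (#U3 + #U4) :=
    (card_le_card hcover).trans ((card_union_le _ _).trans
      (add_le_add (card_union_le _ _) (card_union_le _ _)))
  have hcard' : (#hE.toFinset : ℝ) ≤ #U1 + #U2 + (#U3 + #U4) := by exact_mod_cast hcard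
  rw [Set.ncard_eq_toFinset_card _ hE]
  linarith

/-- Every lattice line `a x + b y = c` with coprime coefficients meets each half-open window of
length `a² + b²` in the coordinate `a y - b x`. -/
theorem exists_int_point_on_line {a b : ℤ} (hab : IsCoprime a b) (hpos : 0 < a ^ 2 + b ^ 2)
    (c t : ℤ) : ∃ x y : ℤ, a * x + b * y = c ∧ t ≤ a * y - b * x ∧
      a * y - b * x < t + (a ^ 2 + b ^ 2) := by
  obtain ⟨e, f, hef⟩ := hab
  set q := a ^ 2 + b ^ 2
  set g := a * (c * f) - b * (c * e) with hg
  have h1 := Int.emod_add_mul_ediv (g - t) q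
  have h2 := Int.emod_nonneg (g - t) hpos.ne'
  have h3 := Int.emod_lt_of_pos (g - t) hpos
  set j := (g - t) / q
  have h4 : a * (c * f - j * a) - b * (c * e + j * b) = t + (g - t) % q := by
    have : a * (c * f - j * a) - b * (c * e + j * b) = g - q * j := by
      simp only [hg, q]; ring
    rw [this]; linarith
  refine ⟨c * e + j * b, c * f - j * a, ?_, ?_, ?_⟩
  · linear_combination c * hef
  · omega
  · omega

theorem sq_add_sq_le_iff_rotated {a b x y : ℤ} {r : ℝ} (hpos : 0 < a ^ 2 + b ^ 2) :
    (x : ℝ) ^ 2 + (y : ℝ) ^ 2 ≤ r ^ 2 ↔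
      ((a * x + b * y : ℤ) : ℝ) ^ 2 + ((a * y - b * x : ℤ) : ℝ) ^ 2 ≤
        ((a ^ 2 + b ^ 2 : ℤ) : ℝ) * r ^ 2 := by
  have hpos' : (0 : ℝ) < ((a ^ 2 + b ^ 2 : ℤ) : ℝ) := by exact_mod_cast hpos
  have : ((a * x + b * y : ℤ) : ℝ) ^ 2 + ((a * y - b * x : ℤ) : ℝ) ^ 2 =
      ((a ^ 2 + b ^ 2 : ℤ) : ℝ) * ((x : ℝ) ^ 2 + (y : ℝ) ^ 2) := by
    push_cast; ring
  rw [this, mul_le_mul_iff_right₀ hpos']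

/-- If a lattice point maximizes over the disk both of the functionals given by `(a, b)` and
`(a', b')`, where `(a, b)` is primitive and all entries lie in `{1, …, n}`, with `n` small in
terms of `r`, then `(a', b')` does not lie to the left of `(a, b)`. -/
theorem mul_le_mul_of_common_maximizer {r : ℝ} {n a b a' b' x y : ℤ}
    (hn : 64000 * (n : ℝ) ^ 3 ≤ r) (ha : 1 ≤ a) (han : a ≤ n) (hb : 1 ≤ b) (hbn : b ≤ n)
    (han' : a' ≤ n) (hbn' : b' ≤ n) (hab : IsCoprime a b)
    (hv : (x : ℝ) ^ 2 + (y : ℝ) ^ 2 ≤ r ^ 2)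
    (hmax : ∀ z w : ℤ, (z : ℝ) ^ 2 + (w : ℝ) ^ 2 ≤ r ^ 2 → a * z + b * w ≤ a * x + b * y)
    (hmax' : ∀ z w : ℤ, (z : ℝ) ^ 2 + (w : ℝ) ^ 2 ≤ r ^ 2 → a' * z + b' * w ≤ a' * x + b' * y) :
    a * b' ≤ b * a' := by
  by_contra! hlt
  have hq : 0 < a ^ 2 + b ^ 2 := by positivity
  set q := a ^ 2 + b ^ 2 with hqdef
  set k := a * x + b * y with hk
  set m := a * y - b * x with hm
  set M := n * (a + b) with hM
  have hqM : q ≤ M := by rw [hqdef, hM]; nlinarith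
  have hM1 : 1 ≤ M := by linarith [show 1 ≤ q by omega]
  have hn1 : (1 : ℝ) ≤ n := by exact_mod_cast ha.trans han
  have hr0 : 0 ≤ r := le_trans (by positivity) hn
  have hk0 : 0 ≤ k := by simpa using hmax 0 0 (by simpa using sq_nonneg r)
  have hnext : (q : ℝ) * r ^ 2 < ((k : ℝ) + 1) ^ 2 + (q : ℝ) ^ 2 := by
    obtain ⟨z, w, hz1, hz2, hz3⟩ := exists_int_point_on_line hab hq (k + 1) 0
    by_contra! hcon
    have hmem : (z : ℝ) ^ 2 + (w : ℝ) ^ 2 ≤ r ^ 2 := by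
      rw [sq_add_sq_le_iff_rotated hq, hz1]
      refine le_trans ?_ hcon
      have h1 : (0 : ℝ) ≤ ((a * w - b * z : ℤ) : ℝ) := by exact_mod_cast hz2
      have h2 : ((a * w - b * z : ℤ) : ℝ) ≤ (q : ℝ) := by
        exact_mod_cast (by omega : a * w - b * z ≤ q)
      have h3 := pow_le_pow_left₀ h1 h2 2
      push_cast at h3 ⊢
      linarith
    have := hmax z w hmem
    omega
  have hdisk : (k : ℝ) ^ 2 + (m : ℝ) ^ 2 ≤ (q : ℝ) * r ^ 2 :=
    (sq_add_sq_le_iff_rotated hq).1 hv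
  have hMr : (M : ℝ) = n * ((a : ℝ) + b) := by rw [hM]; push_cast; ring
  have hqMr : (q : ℝ) ≤ M := by exact_mod_cast hqM
  have hM1r : (1 : ℝ) ≤ M := by exact_mod_cast hM1
  have hkbig : 1000 * (M : ℝ) ^ 2 ≤ k := by
    by_contra! hcon
    have hσ : (a : ℝ) + b ≤ 2 * n := by
      have h1 : (a : ℝ) ≤ n := by exact_mod_cast han
      have h2 : (b : ℝ) ≤ n := by exact_mod_cast hbn
      linarith
    have hσ0 : (0 : ℝ) ≤ (a : ℝ) + b := by exact_mod_cast (by omega : 0 ≤ a + b)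
    have h2q : ((a : ℝ) + b) ^ 2 ≤ 2 * q := by
      rw [hqdef]; push_cast; nlinarith [sq_nonneg ((a : ℝ) - b)]
    have h1 : 32000 * (M : ℝ) ^ 2 ≤ ((a : ℝ) + b) * r := by
      calc 32000 * (M : ℝ) ^ 2 = 32000 * n ^ 2 * ((a : ℝ) + b) * ((a : ℝ) + b) := by
            rw [hMr]; ring
        _ ≤ 32000 * n ^ 2 * ((a : ℝ) + b) * (2 * n) := by gcongr
        _ = ((a : ℝ) + b) * (64000 * (n : ℝ) ^ 3) := by ring
        _ ≤ ((a : ℝ) + b) * r := by gcongr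
    have h2 : (32000 * (M : ℝ) ^ 2) ^ 2 ≤ 2 * (q * r ^ 2) := by
      calc (32000 * (M : ℝ) ^ 2) ^ 2 ≤ (((a : ℝ) + b) * r) ^ 2 := by gcongr
        _ = ((a : ℝ) + b) ^ 2 * r ^ 2 := by ring
        _ ≤ (2 * q) * r ^ 2 := by gcongr
        _ = 2 * (q * r ^ 2) := by ring
    have hk0r : (0 : ℝ) ≤ k := by exact_mod_cast hk0
    have h3 : ((k : ℝ) + 1) ^ 2 ≤ (1000 * (M : ℝ) ^ 2 + 1) ^ 2 := by gcongr
    have h4 : (q : ℝ) ^ 2 ≤ (M : ℝ) ^ 2 := by gcongr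
    have h5 : (1 : ℝ) ≤ (M : ℝ) ^ 2 := one_le_pow₀ hM1r
    nlinarith
  have hm4 : (m : ℝ) ^ 2 ≤ 4 * k := by
    have h4 : (q : ℝ) ^ 2 ≤ (M : ℝ) ^ 2 := by gcongr
    have h5 : (1 : ℝ) ≤ (M : ℝ) ^ 2 := one_le_pow₀ hM1r
    nlinarith
  obtain ⟨z, w, hz1, hz2, hz3⟩ := exists_int_point_on_line hab hq (k - 1) (m + (M + 1))
  set τ := (a * w - b * z) - m with hτ
  have hτ1 : M + 1 ≤ τ := by omega
  have hτ2 : τ ≤ 3 * M := by omega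
  have hmem : (z : ℝ) ^ 2 + (w : ℝ) ^ 2 ≤ r ^ 2 := by
    rw [sq_add_sq_le_iff_rotated hq, hz1, (by omega : a * w - b * z = m + τ)]
    change ((k - 1 : ℤ) : ℝ) ^ 2 + ((m + τ : ℤ) : ℝ) ^ 2 ≤ (q : ℝ) * r ^ 2
    rw [Int.cast_sub k 1, Int.cast_add m τ, Int.cast_one]
    have hτr : (τ : ℝ) ≤ 3 * M := by exact_mod_cast hτ2
    have hτ0 : (0 : ℝ) ≤ τ := by exact_mod_cast (by omega : 0 ≤ τ)
    have h5 : (1 : ℝ) ≤ (M : ℝ) ^ 2 := one_le_pow₀ hM1r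
    have h6 : (τ : ℝ) ^ 2 ≤ 9 * (M : ℝ) ^ 2 := by
      calc (τ : ℝ) ^ 2 ≤ (3 * M) ^ 2 := by gcongr
        _ = _ := by ring
    have h7 : 2 * (m : ℝ) * τ ≤ k / 2 + 8 * τ ^ 2 := by nlinarith [sq_nonneg ((m : ℝ) - 8 * τ)]
    nlinarith
  have hfin := hmax' z w hmem
  have hid : q * (a' * (z - x) + b' * (w - y)) =
      (a * a' + b * b') * (a * (z - x) + b * (w - y)) +
        (a * b' - b * a') * (a * (w - y) - b * (z - x)) := by
    rw [hqdef]; ring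
  have hid1 : a * (z - x) + b * (w - y) = -1 := by linarith
  have hid2 : a * (w - y) - b * (z - x) = τ := by rw [hτ, hm]; ring
  rw [hid1, hid2] at hid
  have h1 : a * a' + b * b' ≤ M := by
    have h1 : a * a' ≤ a * n := by gcongr
    have h2 : b * b' ≤ b * n := by gcongr
    rw [hM]
    linarith
  have h2 : 1 * τ ≤ (a * b' - b * a') * τ := by
    apply mul_le_mul_of_nonneg_right <;> omega
  have h3 : q * (a' * (z - x) + b' * (w - y)) ≤ 0 :=
    mul_nonpos_of_nonneg_of_nonpos hq.le (by linarith)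
  linarith

/-- Every linear functional attains its maximum over a nonempty finite planar set at an extreme
point of the convex hull. -/
theorem exists_extremePoint_maximizer {B : Set (ℝ × ℝ)} (hB : B.Finite) (hne : B.Nonempty)
    (α β : ℝ) : ∃ v ∈ Set.extremePoints ℝ (convexHull ℝ B),
      ∀ w ∈ B, α * w.1 + β * w.2 ≤ α * v.1 + β * v.2 := by
  let f : ℝ × ℝ →L[ℝ] ℝ :=
    α • ContinuousLinearMap.fst ℝ ℝ ℝ + β • ContinuousLinearMap.snd ℝ ℝ ℝ
  have hcomp := hB.isCompact_convexHull (𝕜 := ℝ)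
  obtain ⟨v₀, hv₀, hmax⟩ := hcomp.exists_isMaxOn hne.convexHull f.continuous.continuousOn
  have hexp := ContinuousLinearMap.toExposed.isExposed (l := f) (A := convexHull ℝ B)
  obtain ⟨v, hv⟩ := (hexp.isCompact hcomp).extremePoints_nonempty ⟨v₀, hv₀, fun y hy => hmax hy⟩
  refine ⟨v, hexp.isExtreme.extremePoints_subset_extremePoints hv, fun w hw => ?_⟩
  exact hv.1.2 w (subset_convexHull ℝ B hw)

open Finset in
theorem sq_le_four_mul_ncard_extremePoints_latticeDisk {r : ℝ} (n : ℕ)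
    (hn : 64000 * (n : ℝ) ^ 3 ≤ r) :
    (n : ℝ) ^ 2 ≤ 4 * ((Set.extremePoints ℝ (convexHull ℝ (latticeDisk r))).ncard : ℝ) := by
  have hr : 0 ≤ r := le_trans (by positivity) hn
  have hB := finite_latticeDisk hr
  have hE := hB.subset (extremePoints_latticeDisk_subset r)
  have hne : (latticeDisk r).Nonempty := ⟨((0 : ℤ), (0 : ℤ)), by
    rw [mk_intCast_mem_latticeDisk]; simpa using sq_nonneg r⟩
  choose V hVE hVmax using fun p : ℕ × ℕ =>
    exists_extremePoint_maximizer hB hne (p.1 : ℝ) (p.2 : ℝ)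
  have hcard : #{p ∈ Icc 1 n ×ˢ Icc 1 n | p.1.Coprime p.2} ≤ #hE.toFinset := by
    refine card_le_card_of_injOn V (fun p _ => by simpa using hVE p) ?_
    rintro ⟨a, b⟩ hp ⟨a', b'⟩ hp' heq
    simp only [coe_filter, mem_product, mem_Icc, Set.mem_ofPred_eq] at hp hp'
    obtain ⟨⟨⟨ha, han⟩, hb, hbn⟩, hab⟩ := hp
    obtain ⟨⟨⟨ha', han'⟩, hb', hbn'⟩, hab'⟩ := hp'
    obtain ⟨⟨x, y, hxy⟩, hdisk⟩ := extremePoints_latticeDisk_subset r (hVE (a, b))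
    have hmax : ∀ c d : ℕ, V (c, d) = ((x : ℝ), (y : ℝ)) → ∀ z w : ℤ,
        (z : ℝ) ^ 2 + (w : ℝ) ^ 2 ≤ r ^ 2 → (c : ℤ) * z + d * w ≤ c * x + d * y := by
      intro c d hcd z w hzw
      have := hVmax (c, d) _ (mk_intCast_mem_latticeDisk.2 hzw)
      rw [hcd] at this
      dsimp only at this
      exact_mod_cast this
    rw [hxy] at hdisk
    have hm := hmax a b hxy
    have hm' := hmax a' b' (heq ▸ hxy)
    have hn' : 64000 * (((n : ℤ) : ℝ)) ^ 3 ≤ r := by simpa using hn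
    have h1 := mul_le_mul_of_common_maximizer hn' (by exact_mod_cast ha) (by exact_mod_cast han)
      (by exact_mod_cast hb) (by exact_mod_cast hbn) (by exact_mod_cast han')
      (by exact_mod_cast hbn') (Nat.isCoprime_iff_coprime.2 hab) hdisk hm hm'
    have h2 := mul_le_mul_of_common_maximizer hn' (by exact_mod_cast ha') (by exact_mod_cast han')
      (by exact_mod_cast hb') (by exact_mod_cast hbn') (by exact_mod_cast han)
      (by exact_mod_cast hbn) (Nat.isCoprime_iff_coprime.2 hab') hdisk hm' hm
    have h3 : a * b' = b * a' := by
      have : (a : ℤ) * b' = b * a' := le_antisymm h1 (by linarith)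
      exact_mod_cast this
    have haa : a = a' := Nat.dvd_antisymm
      (hab.dvd_of_dvd_mul_left (h3 ▸ Dvd.intro _ rfl))
      (hab'.dvd_of_dvd_mul_right (h3 ▸ Dvd.intro_left _ rfl))
    subst haa
    have hbb : b' = b := Nat.eq_of_mul_eq_mul_left ha (by linarith)
    rw [hbb]
  have h1 := sq_le_four_mul_card_coprime n
  have h2 : (#{p ∈ Icc 1 n ×ˢ Icc 1 n | p.1.Coprime p.2} : ℝ) ≤ #hE.toFinset := by
    exact_mod_cast hcard
  rw [Set.ncard_eq_toFinset_card _ hE]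
  linarith

/-- Balog–Bárány: the number of vertices (extreme points) of the convex hull of the
integer points in the disk of radius `r` is `Θ(r^{2/3})` for sufficiently large `r`. -/
theorem card_extremePoints_latticeDisk :
    ∃ c C : ℝ, 0 < c ∧ 0 < C ∧ ∃ r₀ : ℝ, ∀ r : ℝ, r₀ ≤ r →
      c * r ^ ((2 : ℝ) / 3) ≤
          ((Set.extremePoints ℝ (convexHull ℝ (latticeDisk r))).ncard : ℝ) ∧
        ((Set.extremePoints ℝ (convexHull ℝ (latticeDisk r))).ncard : ℝ) ≤
          C * r ^ ((2 : ℝ) / 3) := by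
  refine ⟨1 / 25600, 60, by norm_num, by norm_num, 64000, fun r hr => ?_⟩
  have hr0 : 0 ≤ r := by linarith
  set t := r ^ ((1 : ℝ) / 3) with ht
  have ht0 : 0 ≤ t := Real.rpow_nonneg hr0 _
  have ht3 : t ^ 3 = r := by
    rw [ht, ← Real.rpow_natCast, ← Real.rpow_mul hr0]; norm_num
  have ht2 : r ^ ((2 : ℝ) / 3) = t ^ 2 := by
    rw [ht, ← Real.rpow_natCast, ← Real.rpow_mul hr0]; norm_num
  have ht40 : 40 ≤ t := by
    by_contra! hlt
    have : t ^ 3 < 40 ^ 3 := by gcongr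
    norm_num at this
    linarith
  rw [ht2]
  constructor
  · have hle : (⌊t / 40⌋₊ : ℝ) ≤ t / 40 := Nat.floor_le (by positivity)
    have hlt : t / 40 < ⌊t / 40⌋₊ + 1 := Nat.lt_floor_add_one _
    have hge : t / 80 ≤ (⌊t / 40⌋₊ : ℝ) := by
      have : (1 : ℝ) ≤ (⌊t / 40⌋₊ : ℝ) := by
        exact_mod_cast Nat.le_floor (by push_cast; linarith)
      linarith
    have h1 := sq_le_four_mul_ncard_extremePoints_latticeDisk (r := r) ⌊t / 40⌋₊ (by
      calc 64000 * (⌊t / 40⌋₊ : ℝ) ^ 3 ≤ 64000 * (t / 40) ^ 3 := by gcongr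
        _ = r := by rw [← ht3]; ring)
    have h2 : (t / 80) ^ 2 ≤ (⌊t / 40⌋₊ : ℝ) ^ 2 := by gcongr
    linarith
  · have hK : t ≤ ⌈t⌉ := Int.le_ceil t
    have hK' : (⌈t⌉ : ℝ) < t + 1 := Int.ceil_lt_add_one t
    have hKpos : 0 < ⌈t⌉ := Int.ceil_pos.2 (by linarith)
    have h1 := ncard_extremePoints_latticeDisk_le hr0 hKpos
    have h2 : 2 * r / ⌈t⌉ ≤ 2 * t ^ 2 := by
      rw [div_le_iff₀ (by linarith), ← ht3]
      nlinarith [mul_le_mul_of_nonneg_left hK (sq_nonneg t)]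
    have h3 : (⌈t⌉ : ℝ) * (2 * ⌈t⌉ + 1) ≤ (t + 1) * (2 * (t + 1) + 1) := by gcongr
    nlinarith
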